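/- Let p, q > 0. If f ∈ Aut(ℂ^{p+q}) preserves the domain D^{p,q} and the null cone ∂D^{p,q} = {z : -Σ_{i=1}^q |z_i|² + Σ_{i=q+1}^{p+q} |z_i|² = 0}, then f is a linear map belonging to GU(p,q). -/

import Mathlib

open scoped Matrix

noncomputable section

/-- The matrix `J = diag[-E_q, E_p]` of the indefinite Hermitian form of signature `(p,q)`. -/
def Jmat (p q : ℕ) : Matrix (Fin (p+q)) (Fin (p+q)) ℂ :=
  Matrix.diagonal fun i => if (i : ℕ) < q then (-1 : ℂ) else 1

/-- The indefinite Hermitian form `φ(z) = -Σ_{i≤q} |z_i|² + Σ_{i>q} |z_i|²`. -/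
def formPQ (p q : ℕ) (z : Fin (p+q) → ℂ) : ℝ :=
  ∑ i : Fin (p+q), (if (i : ℕ) < q then (-1 : ℝ) else 1) * ‖z i‖ ^ 2

/-- The domain `D^{p,q}`, the positivity set of `φ`. -/
def Dpq (p q : ℕ) : Set (Fin (p+q) → ℂ) := {z | 0 < formPQ p q z}

/-- The null cone `∂D^{p,q} = {z : φ(z) = 0}`. -/
def nullCone (p q : ℕ) : Set (Fin (p+q) → ℂ) := {z | formPQ p q z = 0}

/-- Membership in `GU(p,q)`: `Aᴴ J A = ν J` for some positive real `ν`. -/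
def memGU (p q : ℕ) (A : Matrix (Fin (p+q)) (Fin (p+q)) ℂ) : Prop :=
  ∃ ν : ℝ, 0 < ν ∧ Aᴴ * Jmat p q * A = (ν : ℂ) • Jmat p q

open scoped ComplexConjugate
open scoped ComplexConjugate

lemma real_zero (h : ℂ → ℂ) (hh : Differentiable ℂ h) (h0 : ∀ t : ℝ, h t = 0) (z : ℂ) : h z = 0 := by
  have ha : AnalyticOnNhd ℂ h Set.univ := fun x _ => hh.analyticAt x
  have hb : AnalyticOnNhd ℂ (fun _ : ℂ => (0:ℂ)) Set.univ := fun x _ => analyticAt_const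
  have : h = fun _ => 0 := by
    refine ha.eq_of_frequently_eq (z₀ := 0) hb ?_
    have ht : Filter.Tendsto (fun t : ℝ => (t : ℂ)) (nhdsWithin 0 {0}ᶜ) (nhdsWithin 0 {0}ᶜ) := by
      refine tendsto_nhdsWithin_iff.2 ⟨?_, ?_⟩
      · exact (Complex.continuous_ofReal.tendsto' 0 0 (by simp)).mono_left nhdsWithin_le_nhds
      · filter_upwards [self_mem_nhdsWithin] with t ht
        simpa using ht
    exact ht.frequently (Filter.Frequently.of_forall h0)
  rw [this]

lemma circle_zero (h : ℂ → ℂ) (hh : Differentiable ℂ h) (r : ℝ) (hr : 0 < r)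
    (h0 : ∀ z : ℂ, ‖z‖ = r → h z = 0) : h 0 = 0 := by
  have := Complex.norm_le_of_forall_mem_frontier_norm_le (f := h) (U := Metric.ball 0 r) (C := 0)
    Metric.isBounded_ball hh.diffContOnCl (by
      intro z hz
      rw [frontier_ball _ hr.ne'] at hz
      rw [h0 z (by simpa using hz)]; simp) (z := 0) (subset_closure (by simpa using hr))
  simpa using this

lemma entire_bij (a b : ℂ → ℂ) (ha : Differentiable ℂ a) (hb : Differentiable ℂ b)
    (hba : ∀ z, b (a z) = z) (h0 : a 0 = 0) (h1 : a 1 = 1) (z : ℂ) : a z = z := by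
  obtain ⟨M, hM⟩ : ∃ M : ℝ, ∀ w : ℂ, ‖w‖ ≤ 1 → ‖b w‖ ≤ M := by
    obtain ⟨M, hM⟩ := (isCompact_closedBall (0:ℂ) 1).exists_bound_of_continuousOn hb.continuous.continuousOn
    exact ⟨M, fun w hw => hM w (by simpa using hw)⟩
  have hbig : ∀ z, M < ‖z‖ → 1 < ‖a z‖ := by
    intro z hz
    by_contra hc
    have := hM (a z) (not_lt.1 hc)
    rw [hba] at this; linarith
  have hda : deriv a 0 ≠ 0 := by
    intro hd
    have h := ((hb (a 0)).hasDerivAt.comp (0:ℂ) (ha 0).hasDerivAt)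
    rw [hd, mul_zero] at h
    have h' : HasDerivAt (fun z : ℂ => z) 1 0 := hasDerivAt_id 0
    have e : b ∘ a = fun z => z := funext hba
    rw [e] at h
    exact one_ne_zero (h'.unique h)
  have dsl : ∀ u : ℂ → ℂ, Differentiable ℂ u → Differentiable ℂ (dslope u 0) := by
    intro u hu
    rw [← differentiableOn_univ] at hu ⊢
    exact (Complex.differentiableOn_dslope Filter.univ_mem).2 hu
  have hk : ∀ z, a z = z * dslope a 0 z := by
    intro z
    have := sub_smul_dslope a 0 z
    simpa [h0] using this.symm
  have hk0 : ∀ z, dslope a 0 z ≠ 0 := by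
    intro z hz
    by_cases hz0 : z = 0
    · subst hz0; rw [dslope_same] at hz; exact hda hz
    · have e := hk z
      rw [hz, mul_zero] at e
      apply hz0
      rw [← hba z, e, ← h0, hba, h0]
  set u : ℂ → ℂ := fun z => (dslope a 0 z)⁻¹ with hu
  have hud : Differentiable ℂ u := (dsl a ha).inv hk0
  have hv := dsl u hud
  have huv : ∀ z, u z = u 0 + z * dslope u 0 z := by
    intro z
    have := sub_smul_dslope u 0 z
    simp only [sub_zero, smul_eq_mul] at this
    rw [this]; ring
  have hub : ∀ z, M < ‖z‖ → ‖u z‖ ≤ ‖z‖ := by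
    intro z hz
    have h1 := hbig z hz
    rw [hk z, norm_mul] at h1
    have h2 : 0 < ‖dslope a 0 z‖ := norm_pos_iff.2 (hk0 z)
    simp only [hu, norm_inv]
    rw [inv_le_iff_one_le_mul₀ h2]
    linarith
  have hbd : Bornology.IsBounded (Set.range (dslope u 0)) := by
    obtain ⟨N, hN⟩ := (isCompact_closedBall (0:ℂ) (max M 1)).exists_bound_of_continuousOn hv.continuous.continuousOn
    rw [isBounded_iff_forall_norm_le]
    refine ⟨max N (1 + ‖u 0‖), ?_⟩
    rintro _ ⟨z, rfl⟩
    by_cases hz : ‖z‖ ≤ max M 1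
    · exact (hN z (by simpa using hz)).trans (le_max_left _ _)
    · push Not at hz
      have hz1 : M < ‖z‖ := (le_max_left _ _).trans_lt hz
      have hz2 : 1 < ‖z‖ := (le_max_right _ _).trans_lt hz
      refine le_trans ?_ (le_max_right _ _)
      have e : z * dslope u 0 z = u z - u 0 := by rw [huv z]; ring
      have e2 : ‖z‖ * ‖dslope u 0 z‖ ≤ ‖z‖ + ‖u 0‖ := by
        rw [← norm_mul, e]
        exact (norm_sub_le _ _).trans (by linarith [hub z hz1])
      by_contra hc
      push Not at hc
      nlinarith [norm_nonneg (u 0)]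
  obtain ⟨c, hc⟩ := hv.exists_const_forall_eq_of_bounded hbd
  have hc0 : c = 0 := by
    by_contra hne
    have := huv (-(u 0) / c)
    rw [hc] at this
    have e : u (-(u 0) / c) = 0 := by rw [this]; field_simp; ring
    exact inv_ne_zero (hk0 _) e
  have huc : ∀ z, u z = u 0 := by intro z; rw [huv z, hc, hc0]; simp
  have hkc : ∀ z, dslope a 0 z = dslope a 0 0 := by
    intro z; exact inv_injective (huc z)
  have e1 := hk 1
  rw [h1, hkc, one_mul] at e1
  rw [hk z, hkc, ← e1, mul_one]

/-- The sesquilinear form polarizing `formPQ`. -/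
def BB (p q : ℕ) (z w : Fin (p+q) → ℂ) : ℂ :=
  ∑ i : Fin (p+q), (if (i : ℕ) < q then (-1 : ℂ) else 1) * (z i * conj (w i))

lemma BB_add_left (p q : ℕ) (x y w : Fin (p+q) → ℂ) : BB p q (x + y) w = BB p q x w + BB p q y w := by
  simp only [BB, ← Finset.sum_add_distrib, Pi.add_apply]
  exact Finset.sum_congr rfl fun i _ => by ring

lemma BB_smul_left (p q : ℕ) (c : ℂ) (x w : Fin (p+q) → ℂ) : BB p q (c • x) w = c * BB p q x w := by
  simp only [BB, Finset.mul_sum, Pi.smul_apply, smul_eq_mul]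
  exact Finset.sum_congr rfl fun i _ => by ring

lemma BB_conj (p q : ℕ) (x w : Fin (p+q) → ℂ) : conj (BB p q x w) = BB p q w x := by
  simp only [BB, map_sum]
  refine Finset.sum_congr rfl fun i _ => ?_
  split_ifs <;> simp [mul_comm]

lemma BB_add_right (p q : ℕ) (x y w : Fin (p+q) → ℂ) : BB p q w (x + y) = BB p q w x + BB p q w y := by
  rw [← BB_conj, BB_add_left, map_add, BB_conj, BB_conj]

lemma BB_smul_right (p q : ℕ) (c : ℂ) (x w : Fin (p+q) → ℂ) : BB p q w (c • x) = conj c * BB p q w x := by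
  rw [← BB_conj, BB_smul_left, map_mul, BB_conj]

lemma BB_self (p q : ℕ) (x : Fin (p+q) → ℂ) : BB p q x x = (formPQ p q x : ℂ) := by
  simp only [BB, formPQ, Complex.ofReal_sum]
  refine Finset.sum_congr rfl fun i _ => ?_
  rw [Complex.mul_conj, Complex.normSq_eq_norm_sq]
  split_ifs <;> simp

lemma BB_symm_zero (p q : ℕ) {x w : Fin (p+q) → ℂ} (h : BB p q x w = 0) : BB p q w x = 0 := by
  rw [← BB_conj, h, map_zero]

lemma BB_single_right (p q : ℕ) (x : Fin (p+q) → ℂ) (i : Fin (p+q)) :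
    BB p q x (Pi.single i 1) = (if (i : ℕ) < q then (-1 : ℂ) else 1) * x i := by
  simp only [BB]
  rw [Finset.sum_eq_single i]
  · simp
  · intro j _ hj; simp [hj]
  · simp

lemma BB_nondeg (p q : ℕ) (x : Fin (p+q) → ℂ) (h : ∀ u, BB p q x u = 0) : x = 0 := by
  funext i
  have := h (Pi.single i 1)
  rw [BB_single_right] at this
  split_ifs at this <;> simpa using this

lemma formPQ_single (p q : ℕ) (i : Fin (p+q)) :
    formPQ p q (Pi.single i 1) = (if (i : ℕ) < q then (-1 : ℝ) else 1) := by
  have := BB_self p q (Pi.single i 1)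
  rw [BB_single_right] at this
  apply Complex.ofReal_injective
  rw [← this]
  split_ifs <;> simp

lemma formPQ_smul (p q : ℕ) (c : ℂ) (x : Fin (p+q) → ℂ) :
    formPQ p q (c • x) = ‖c‖ ^ 2 * formPQ p q x := by
  simp only [formPQ, Finset.mul_sum, Pi.smul_apply, smul_eq_mul, norm_mul]
  exact Finset.sum_congr rfl fun i _ => by ring

lemma formPQ_add_orth (p q : ℕ) (x y : Fin (p+q) → ℂ) (h : BB p q x y = 0) :
    formPQ p q (x + y) = formPQ p q x + formPQ p q y := by
  apply Complex.ofReal_injective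
  push_cast
  rw [← BB_self, ← BB_self, ← BB_self, BB_add_left, BB_add_right, BB_add_right, h, BB_symm_zero p q h]
  ring

lemma formPQ_cont (p q : ℕ) : Continuous (formPQ p q) := by
  unfold formPQ; fun_prop

lemma exists_small_neg (p q : ℕ) (y u : Fin (p+q) → ℂ) (hy : formPQ p q y < 0) :
    ∃ t : ℂ, t ≠ 0 ∧ formPQ p q (y + t • u) < 0 := by
  have hc : Continuous fun t : ℂ => formPQ p q (y + t • u) :=
    (formPQ_cont p q).comp (by fun_prop)
  have h1 : ∀ᶠ t in nhds (0:ℂ), formPQ p q (y + t • u) < 0 :=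
    hc.continuousAt.eventually (gt_mem_nhds (by simpa using hy))
  have h2 : ∀ᶠ t in nhdsWithin (0:ℂ) {0}ᶜ, formPQ p q (y + t • u) < 0 := h1.filter_mono nhdsWithin_le_nhds
  obtain ⟨t, ht, ht0⟩ := (h2.and self_mem_nhdsWithin).exists
  exact ⟨t, ht0, ht⟩

/-- projection off a positive vector -/
lemma BB_proj (p q : ℕ) (v u : Fin (p+q) → ℂ) (hv : 0 < formPQ p q v) :
    BB p q (u - (BB p q u v / formPQ p q v) • v) v = 0 := by
  have : (formPQ p q v : ℂ) ≠ 0 := by exact_mod_cast hv.ne'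
  rw [sub_eq_add_neg, ← neg_smul, BB_add_left, BB_smul_left, BB_self]
  field_simp
  ring

lemma proj_form_le (p q : ℕ) (v u : Fin (p+q) → ℂ) (hv : 0 < formPQ p q v) :
    formPQ p q (u - (BB p q u v / formPQ p q v) • v) ≤ formPQ p q u := by
  set c := BB p q u v / formPQ p q v
  have h := BB_proj p q v u hv
  have h2 : BB p q (u - c • v) (c • v) = 0 := by rw [BB_smul_right, h, mul_zero]
  have := formPQ_add_orth p q _ _ h2
  rw [sub_add_cancel, formPQ_smul] at this
  have : 0 ≤ ‖c‖ ^ 2 * formPQ p q v := by positivity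
  linarith

lemma neg_exists (p q : ℕ) (hq : 0 < q) (v : Fin (p+q) → ℂ) (hv : 0 < formPQ p q v) :
    ∃ y, BB p q y v = 0 ∧ formPQ p q y < 0 := by
  refine ⟨_, BB_proj p q v (Pi.single ⟨0, by omega⟩ 1) hv, (proj_form_le p q v _ hv).trans_lt ?_⟩
  rw [formPQ_single]; simp [hq]

/-- A vector orthogonal to all negative vectors in `v^⊥` is a multiple of `v`. -/
lemma span_lemma (p q : ℕ) (hq : 0 < q) (v x : Fin (p+q) → ℂ) (hv : 0 < formPQ p q v)
    (hx : ∀ y, BB p q y v = 0 → formPQ p q y < 0 → BB p q x y = 0) :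
    x = (BB p q x v / formPQ p q v) • v := by
  obtain ⟨y, hy, hy0⟩ := neg_exists p q hq v hv
  set c := BB p q x v / formPQ p q v with hc
  have hxv : BB p q (x - c • v) v = 0 := BB_proj p q v x hv
  have key : ∀ u, BB p q u v = 0 → BB p q x u = 0 := by
    intro u hu
    obtain ⟨t, ht, htn⟩ := exists_small_neg p q y u hy0
    have h1 := hx _ (by rw [BB_add_left, BB_smul_left, hy, hu]; simp) htn
    rw [BB_add_right, hx y hy hy0, zero_add, BB_smul_right] at h1
    simpa [ht] using h1
  have key2 : ∀ u, BB p q u v = 0 → BB p q (x - c • v) u = 0 := by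
    intro u hu
    rw [sub_eq_add_neg, ← neg_smul, BB_add_left, BB_smul_left, key u hu, BB_symm_zero p q hu]; simp
  have : x - c • v = 0 := by
    apply BB_nondeg p q
    intro u
    have h := key2 _ (BB_proj p q v u hv)
    rwa [sub_eq_add_neg u, ← neg_smul, BB_add_right, BB_smul_right, hxv, mul_zero, add_zero] at h
  exact sub_eq_zero.1 this

lemma BB_diff (p q : ℕ) (G1 G2 : ℂ → Fin (p+q) → ℂ) (h1 : Differentiable ℂ G1)
    (h2 : Differentiable ℂ G2) : Differentiable ℂ fun a => BB p q (G1 a) (G2 (conj a)) := by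
  unfold BB
  have h3 : ∀ i, Differentiable ℂ fun a => conj (G2 (conj a) i) := by
    intro i a
    have h := ((differentiable_pi.1 h2 i) (conj a)).conj_conj
    rw [Complex.conj_conj] at h
    exact h
  have h4 := differentiable_pi.1 h1
  refine Differentiable.fun_sum fun i _ => ?_
  exact ((h4 i).mul (h3 i)).const_mul _

section
variable (p q : ℕ) (f : (Fin (p+q) → ℂ) → (Fin (p+q) → ℂ)) (hf : Differentiable ℂ f)
  (hnull : ∀ z, formPQ p q z = 0 → formPQ p q (f z) = 0)

lemma polar (hf : Differentiable ℂ f)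
    (hnull : ∀ z, formPQ p q z = 0 → formPQ p q (f z) = 0)
    (x : Fin (p+q) → ℂ) (hx : formPQ p q x = 0) (a b : ℂ) :
    BB p q (f (a • x)) (f (b • x)) = 0 := by
  have s0 : ∀ c : ℂ, BB p q (f (c • x)) (f (c • x)) = 0 := by
    intro c
    rw [BB_self, hnull _ (by rw [formPQ_smul, hx, mul_zero])]; simp
  have s1 : ∀ (s : ℝ) (t : ℂ), BB p q (f ((s + Complex.I * t) • x)) (f ((s + Complex.I * conj t) • x)) = 0 := by
    intro s
    apply real_zero (fun t => BB p q (f ((s + Complex.I * t) • x)) (f ((s + Complex.I * conj t) • x)))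
    · exact BB_diff p q (fun t => f ((s + Complex.I * t) • x)) (fun t => f ((s + Complex.I * t) • x))
        (hf.comp (by fun_prop)) (hf.comp (by fun_prop))
    · intro t
      simp only [Complex.conj_ofReal]
      exact s0 _
  have s2 : ∀ (t s : ℂ), BB p q (f ((s + Complex.I * t) • x)) (f ((conj s + Complex.I * conj t) • x)) = 0 := by
    intro t
    apply real_zero (fun s => BB p q (f ((s + Complex.I * t) • x)) (f ((conj s + Complex.I * conj t) • x)))
    · exact BB_diff p q (fun s => f ((s + Complex.I * t) • x)) (fun s => f ((s + Complex.I * conj t) • x))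
        (hf.comp (by fun_prop)) (hf.comp (by fun_prop))
    · intro s
      simp only [Complex.conj_ofReal]
      exact s1 s t
  have h := s2 ((a - conj b) / (2 * Complex.I)) ((a + conj b) / 2)
  have e1 : (a + conj b) / 2 + Complex.I * ((a - conj b) / (2 * Complex.I)) = a := by
    field_simp; ring
  have e2 : conj ((a + conj b) / 2) + Complex.I * conj ((a - conj b) / (2 * Complex.I)) = b := by
    simp only [map_div₀, map_add, map_sub, map_mul, Complex.conj_conj, Complex.conj_I, map_ofNat]
    field_simp; ring
  rwa [e1, e2] at h

lemma orth (hf : Differentiable ℂ f)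
    (hnull : ∀ z, formPQ p q z = 0 → formPQ p q (f z) = 0)
    (z w : Fin (p+q) → ℂ) (hz : 0 < formPQ p q z) (hw : formPQ p q w < 0) (h : BB p q z w = 0) :
    BB p q (f w) (f z) = 0 := by
  set ρ : ℝ := -formPQ p q w / formPQ p q z with hρ
  have hρ0 : 0 < ρ := div_pos (by linarith) hz
  have hd : Differentiable ℂ fun a : ℂ => BB p q (f (a • z + w)) (f (z + ((ρ⁻¹ : ℝ) * conj a : ℂ) • w)) :=
    BB_diff p q (fun a => f (a • z + w)) (fun a => f (z + ((ρ⁻¹ : ℝ) * a : ℂ) • w))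
        (hf.comp (by fun_prop)) (hf.comp (by fun_prop))
  have := circle_zero _ hd (√ρ) (by positivity) (by
    intro a ha
    have ha2 : ‖a‖ ^ 2 = ρ := by rw [ha, Real.sq_sqrt hρ0.le]
    have ha0 : a ≠ 0 := by
      intro h0; rw [h0] at ha2; simp at ha2; linarith
    have hn : formPQ p q (a • z + w) = 0 := by
      rw [formPQ_add_orth _ _ _ _ (by rw [BB_smul_left, h, mul_zero]), formPQ_smul, ha2, hρ]
      field_simp; ring
    have e : z + ((ρ⁻¹ : ℝ) * conj a : ℂ) • w = a⁻¹ • (a • z + w) := by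
      rw [smul_add, inv_smul_smul₀ ha0]
      congr 2
      have h3 : a * conj a = (ρ : ℂ) := by
        rw [Complex.mul_conj, Complex.normSq_eq_norm_sq, ha2]
      have h4 : (ρ : ℂ) ≠ 0 := by exact_mod_cast hρ0.ne'
      apply eq_inv_of_mul_eq_one_left
      push_cast
      rw [mul_assoc, mul_comm _ a, h3, inv_mul_cancel₀ h4]
    have := polar p q f hf hnull _ hn 1 a⁻¹
    rw [one_smul, ← e] at this
    exact this)
  simpa using this

end

/-- Everything about lines. -/
lemma homog (p q : ℕ) (hq : 0 < q)
    (f g : (Fin (p+q) → ℂ) → (Fin (p+q) → ℂ))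
    (hf : Differentiable ℂ f) (hg : Differentiable ℂ g)
    (hgf : ∀ z, g (f z) = z) (hfg : ∀ z, f (g z) = z)
    (f0 : f 0 = 0) (g0 : g 0 = 0)
    (fpos : ∀ z, 0 < formPQ p q (f z) ↔ 0 < formPQ p q z)
    (fnull : ∀ z, formPQ p q (f z) = 0 ↔ formPQ p q z = 0)
    (fneg : ∀ z, formPQ p q (f z) < 0 ↔ formPQ p q z < 0)
    (z : Fin (p+q) → ℂ) (hz : 0 < formPQ p q z) (c : ℂ) : f (c • z) = c • f z := by
  have line : ∀ (f g : (Fin (p+q) → ℂ) → (Fin (p+q) → ℂ)) (_ : Differentiable ℂ f) (_ : Differentiable ℂ g)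
      (_ : ∀ z, g (f z) = z) (_ : ∀ z, f (g z) = z) (_ : f 0 = 0)
      (_ : ∀ z, 0 < formPQ p q (f z) ↔ 0 < formPQ p q z)
      (_ : ∀ z, formPQ p q (f z) = 0 ↔ formPQ p q z = 0)
      (_ : ∀ z, formPQ p q (f z) < 0 ↔ formPQ p q z < 0)
      (z : Fin (p+q) → ℂ) (_ : 0 < formPQ p q z) (c : ℂ),
      f (c • z) = (BB p q (f (c • z)) (f z) / formPQ p q (f z)) • f z := by
    intro f g hf hg hgf hfg f0 fpos fnull fneg z hz c
    by_cases hc : c = 0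
    · subst hc; rw [zero_smul, f0]
      have : BB p q 0 (f z) = 0 := by simp [BB]
      rw [this]; simp
    apply span_lemma p q hq _ _ ((fpos z).2 hz)
    intro y hy hyn
    have hgn : formPQ p q (g y) < 0 := by rw [← fneg, hfg]; exact hyn
    have h1 : BB p q (g y) (g (f z)) = 0 := by
      refine orth p q g hg (fun x hx => ?_) (f z) y ((fpos z).2 hz) hyn (BB_symm_zero p q hy)
      rw [← fnull, hfg]; exact hx
    rw [hgf] at h1
    have h2 := orth p q f hf (fun x hx => (fnull x).2 hx) (c • z) (g y)
      (by rw [formPQ_smul]; positivity) hgn (by rw [BB_smul_left, BB_symm_zero p q h1, mul_zero])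
    rw [hfg] at h2
    exact BB_symm_zero p q h2
  have gpos : ∀ z, 0 < formPQ p q (g z) ↔ 0 < formPQ p q z := fun z => by rw [← fpos, hfg]
  have gnull : ∀ z, formPQ p q (g z) = 0 ↔ formPQ p q z = 0 := fun z => by rw [← fnull, hfg]
  have gneg : ∀ z, formPQ p q (g z) < 0 ↔ formPQ p q z < 0 := fun z => by rw [← fneg, hfg]
  have hfz := (fpos z).2 hz
  have lf := line f g hf hg hgf hfg f0 fpos fnull fneg z hz
  have lg := line g f hg hf hfg hgf g0 gpos gnull gneg (f z) hfz
  rw [hgf] at lg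
  set a : ℂ → ℂ := fun c => BB p q (f (c • z)) (f z) / formPQ p q (f z) with ha
  set b : ℂ → ℂ := fun c => BB p q (g (c • f z)) z / formPQ p q z with hb
  have lf' : ∀ c, f (c • z) = a c • f z := lf
  have lg' : ∀ c, g (c • f z) = b c • z := lg
  have hda : Differentiable ℂ a :=
    (BB_diff p q (fun c => f (c • z)) (fun _ => f z) (hf.comp (by fun_prop)) (by fun_prop)).div_const _
  have hdb : Differentiable ℂ b :=
    (BB_diff p q (fun c => g (c • f z)) (fun _ => z) (hg.comp (by fun_prop)) (by fun_prop)).div_const _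
  have hz0 : z ≠ 0 := by
    rintro rfl
    simp [formPQ] at hz
  have hfz0 : f z ≠ 0 := by
    intro h0
    rw [h0] at hfz
    simp [formPQ] at hfz
  rw [lf' c]
  congr 1
  refine entire_bij a b hda hdb ?_ ?_ ?_ c
  · intro c
    have h := lg' (a c)
    rw [← lf', hgf] at h
    exact (smul_left_injective ℂ hz0 h).symm
  · have h := lf' 0
    rw [zero_smul, f0] at h
    simpa [hfz0] using h.symm
  · have h := lf' 1
    rw [one_smul] at h
    exact (smul_left_injective ℂ hfz0 (by simpa using h)).symm

lemma zero_fixed (p q : ℕ) (hp : 0 < p) (hq : 0 < q)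
    (f g : (Fin (p+q) → ℂ) → (Fin (p+q) → ℂ))
    (hf : Differentiable ℂ f)
    (hfg : ∀ z, f (g z) = z)
    (fnull : ∀ z, formPQ p q (f z) = 0 ↔ formPQ p q z = 0)
    (fneg : ∀ z, formPQ p q (f z) < 0 ↔ formPQ p q z < 0) : f 0 = 0 := by
  have key : ∀ y, formPQ p q y < 0 → BB p q (f 0) y = 0 := by
    intro y hy
    have hgn : formPQ p q (g y) < 0 := by rw [← fneg, hfg]; exact hy
    -- a positive vector orthogonal to `g y`
    obtain ⟨z, hz, hzo⟩ : ∃ z, 0 < formPQ p q z ∧ BB p q z (g y) = 0 := by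
      set w := g y
      set e : Fin (p+q) → ℂ := Pi.single ⟨q, by omega⟩ 1
      have he : formPQ p q e = 1 := by rw [formPQ_single]; simp
      set c := BB p q e w / formPQ p q w
      have hne : (formPQ p q w : ℂ) ≠ 0 := by exact_mod_cast hgn.ne
      have h0 : BB p q (e - c • w) w = 0 := by
        rw [sub_eq_add_neg, ← neg_smul, BB_add_left, BB_smul_left, BB_self]
        simp only [c]; field_simp; ring
      refine ⟨e - c • w, ?_, h0⟩
      have h2 : BB p q (e - c • w) (c • w) = 0 := by rw [BB_smul_right, h0, mul_zero]
      have := formPQ_add_orth p q _ _ h2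
      rw [sub_add_cancel, formPQ_smul, he] at this
      nlinarith [sq_nonneg ‖c‖]
    have hd := BB_diff p q (fun c => f (c • z)) (fun _ => f (g y)) (hf.comp (by fun_prop)) (by fun_prop)
    have := circle_zero _ hd 1 one_pos (by
      intro c hc
      have hc0 : c ≠ 0 := by rintro rfl; simp at hc
      exact BB_symm_zero p q (orth p q f hf (fun x hx => (fnull x).2 hx) (c • z) (g y)
        (by rw [formPQ_smul]; positivity) hgn (by rw [BB_smul_left, hzo, mul_zero])))
    simpa [hfg] using this
  apply BB_nondeg p q
  intro u
  have hy0 : formPQ p q (Pi.single ⟨0, by omega⟩ 1) < 0 := by rw [formPQ_single]; simp [hq]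
  obtain ⟨t, ht, htn⟩ := exists_small_neg p q _ u hy0
  have h1 := key _ htn
  rw [BB_add_right, key _ hy0, zero_add, BB_smul_right] at h1
  simpa [ht] using h1

lemma line_zero (h : ℂ → ℂ) (hh : Differentiable ℂ h) (h0 : ∀ᶠ t in nhds (0:ℂ), h t = 0) (z : ℂ) : h z = 0 := by
  have ha : AnalyticOnNhd ℂ h Set.univ := fun x _ => hh.analyticAt x
  have hb : AnalyticOnNhd ℂ (fun _ : ℂ => (0:ℂ)) Set.univ := fun x _ => analyticAt_const
  rw [ha.eq_of_eventuallyEq (z₀ := 0) hb h0]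

lemma homog_all (p q : ℕ) (hp : 0 < p) (f : (Fin (p+q) → ℂ) → (Fin (p+q) → ℂ))
    (hf : Differentiable ℂ f)
    (h : ∀ z, 0 < formPQ p q z → ∀ c : ℂ, f (c • z) = c • f z) (z : Fin (p+q) → ℂ) (c : ℂ) :
    f (c • z) = c • f z := by
  funext i
  set e : Fin (p+q) → ℂ := Pi.single ⟨q, by omega⟩ 1
  have he : formPQ p q e = 1 := by rw [formPQ_single]; simp
  have hd : Differentiable ℂ fun t : ℂ => f (c • (e + t • (z - e))) i - c * f (e + t • (z - e)) i := by
    have h1 : Differentiable ℂ fun t : ℂ => f (c • (e + t • (z - e))) := hf.comp (by fun_prop)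
    have h2 : Differentiable ℂ fun t : ℂ => f (e + t • (z - e)) := hf.comp (by fun_prop)
    exact (differentiable_pi.1 h1 i).sub ((differentiable_pi.1 h2 i).const_mul c)
  have hc : Continuous fun t : ℂ => formPQ p q (e + t • (z - e)) :=
    (formPQ_cont p q).comp (by fun_prop)
  have hev : ∀ᶠ t in nhds (0:ℂ), 0 < formPQ p q (e + t • (z - e)) :=
    hc.continuousAt.eventually (lt_mem_nhds (by simp [he]))
  have := line_zero _ hd (by
    filter_upwards [hev] with t ht
    rw [h _ ht]; simp) 1
  simpa [sub_eq_zero] using this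

lemma linear_of_homog {n : ℕ} (f : (Fin n → ℂ) → (Fin n → ℂ))
    (hf : Differentiable ℂ f) (h : ∀ z (c : ℂ), f (c • z) = c • f z) (z : Fin n → ℂ) :
    f z = fderiv ℂ f 0 z := by
  have h1 : HasDerivAt (fun c : ℂ => c • z) z 0 := by
    simpa using (hasDerivAt_id (0:ℂ)).smul_const z
  have h2 : HasFDerivAt f (fderiv ℂ f 0) ((0:ℂ) • z) := by
    rw [zero_smul]; exact (hf 0).hasFDerivAt
  have h3 := h2.comp_hasDerivAt (0:ℂ) h1
  have h4 : HasDerivAt (fun c : ℂ => c • f z) (f z) 0 := by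
    simpa using (hasDerivAt_id (0:ℂ)).smul_const (f z)
  have e : (f ∘ fun c : ℂ => c • z) = fun c => c • f z := funext fun c => h z c
  rw [e] at h3
  exact h4.unique h3

lemma memGU_of_orth (p q : ℕ) (hp : 0 < p) (hq : 0 < q) (A : Matrix (Fin (p+q)) (Fin (p+q)) ℂ)
    (hpos : ∀ z, 0 < formPQ p q z → 0 < formPQ p q (A.mulVec z))
    (ho : ∀ z w, 0 < formPQ p q z → formPQ p q w < 0 → BB p q z w = 0 →
      BB p q (A.mulVec z) (A.mulVec w) = 0) : memGU p q A := by
  have hss : ∀ i j : Fin (p+q), BB p q (Pi.single i 1) (Pi.single j 1) =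
      if i = j then (if (i : ℕ) < q then (-1 : ℂ) else 1) else 0 := by
    intro i j
    rw [BB_single_right]
    by_cases h : i = j
    · subst h; simp
    · simp [h, Pi.single_apply, Ne.symm h]
  set e : Fin (p+q) → (Fin (p+q) → ℂ) := fun i => Pi.single i 1 with he
  set T : Fin (p+q) → Fin (p+q) → ℂ := fun i j => BB p q (A.mulVec (e i)) (A.mulVec (e j)) with hT
  have hfe : ∀ i, formPQ p q (e i) = (if (i : ℕ) < q then (-1 : ℝ) else 1) := formPQ_single p q
  have hconj : ∀ i j, T i j = 0 → T j i = 0 := fun i j h => BB_symm_zero p q h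
  have hf : ∀ (x : Fin (p+q) → ℂ) (r : ℝ), BB p q x x = (r : ℂ) → formPQ p q x = r := by
    intro x r h
    rw [BB_self] at h; exact_mod_cast h
  have hss' : ∀ i j : Fin (p+q), BB p q (e i) (e j) =
      if i = j then (if (i : ℕ) < q then (-1 : ℂ) else 1) else 0 := hss
  have h2c : conj (2:ℂ) = 2 := map_ofNat _ 2
  -- mixed signs
  have t1 : ∀ i k : Fin (p+q), (i : ℕ) < q → ¬ (k : ℕ) < q → T k i = 0 := by
    intro i k hi hk
    have hik : k ≠ i := by rintro rfl; exact hk hi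
    exact ho _ _ (by rw [hfe]; simp [hk]) (by rw [hfe]; simp [hi]) (by rw [hss']; simp [hik])
  have t2 : ∀ i k : Fin (p+q), (i : ℕ) < q → ¬ (k : ℕ) < q → T i i = - T k k := by
    intro i k hi hk
    have hik : k ≠ i := by rintro rfl; exact hk hi
    have h := ho (e i + (2:ℂ) • e k) ((2:ℂ) • e i + e k)
      (by rw [hf _ 3]; · norm_num
          simp only [BB_add_left, BB_add_right, BB_smul_left, BB_smul_right, hss', h2c]
          simp [hi, hk, hik, hik.symm]; norm_num)
      (by rw [hf _ (-3)]; · norm_num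
          simp only [BB_add_left, BB_add_right, BB_smul_left, BB_smul_right, hss', h2c]
          simp [hi, hk, hik, hik.symm]; norm_num)
      (by simp only [BB_add_left, BB_add_right, BB_smul_left, BB_smul_right, hss', h2c]
          simp [hi, hk, hik, hik.symm])
    simp only [Matrix.mulVec_add, Matrix.mulVec_smul, BB_add_left, BB_add_right, BB_smul_left,
      BB_smul_right, h2c] at h
    have h1 : BB p q (A.mulVec (e k)) (A.mulVec (e i)) = 0 := t1 i k hi hk
    have h2 := BB_symm_zero p q h1
    rw [h1, h2] at h
    simp only [hT]
    linear_combination h / 2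
  have t3 : ∀ i j k : Fin (p+q), i ≠ j → (i : ℕ) < q → (j : ℕ) < q → ¬ (k : ℕ) < q → T i j = 0 := by
    intro i j k hij hi hj hk
    have hik : k ≠ i := by rintro rfl; exact hk hi
    have hjk : k ≠ j := by rintro rfl; exact hk hj
    have h := ho (e i + (2:ℂ) • e k) ((2:ℂ) • e i + e k + e j)
      (by rw [hf _ 3]; · norm_num
          simp only [BB_add_left, BB_add_right, BB_smul_left, BB_smul_right, hss', h2c]
          simp [hi, hk, hik, hik.symm]; norm_num)
      (by rw [hf _ (-4)]; · norm_num
          simp only [BB_add_left, BB_add_right, BB_smul_left, BB_smul_right, hss', h2c]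
          simp [hi, hk, hj, hik, hik.symm, hjk, hjk.symm, hij, hij.symm]; norm_num)
      (by simp only [BB_add_left, BB_add_right, BB_smul_left, BB_smul_right, hss', h2c]
          simp [hi, hk, hik, hik.symm, hjk, hij])
    simp only [Matrix.mulVec_add, Matrix.mulVec_smul, BB_add_left, BB_add_right, BB_smul_left,
      BB_smul_right, h2c] at h
    have h1 : BB p q (A.mulVec (e k)) (A.mulVec (e i)) = 0 := t1 i k hi hk
    have h2 := BB_symm_zero p q h1
    have h3 : BB p q (A.mulVec (e k)) (A.mulVec (e j)) = 0 := t1 j k hj hk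
    have h4 := t2 i k hi hk
    simp only [hT] at h4
    rw [h1, h2, h3, h4] at h
    simp only [hT]
    linear_combination h
  have t4 : ∀ i j k : Fin (p+q), i ≠ j → ¬ (i : ℕ) < q → ¬ (j : ℕ) < q → (k : ℕ) < q → T j i = 0 := by
    intro i j k hij hi hj hk
    have hik : k ≠ i := by rintro rfl; exact hi hk
    have hjk : k ≠ j := by rintro rfl; exact hj hk
    have h := ho ((2:ℂ) • e i + e k + e j) (e i + (2:ℂ) • e k)
      (by rw [hf _ 4]; · norm_num
          simp only [BB_add_left, BB_add_right, BB_smul_left, BB_smul_right, hss', h2c]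
          simp [hi, hk, hj, hik, hik.symm, hjk, hjk.symm, hij, hij.symm]; norm_num)
      (by rw [hf _ (-3)]; · norm_num
          simp only [BB_add_left, BB_add_right, BB_smul_left, BB_smul_right, hss', h2c]
          simp [hi, hk, hik, hik.symm]; norm_num)
      (by simp only [BB_add_left, BB_add_right, BB_smul_left, BB_smul_right, hss', h2c]
          simp [hi, hk, hik, hik.symm, hjk.symm, hij.symm])
    simp only [Matrix.mulVec_add, Matrix.mulVec_smul, BB_add_left, BB_add_right, BB_smul_left,
      BB_smul_right, h2c] at h
    have h1 : BB p q (A.mulVec (e i)) (A.mulVec (e k)) = 0 := t1 k i hk hi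
    have h2 := BB_symm_zero p q h1
    have h3 : BB p q (A.mulVec (e j)) (A.mulVec (e k)) = 0 := t1 k j hk hj
    have h4 := t2 k i hk hi
    simp only [hT] at h4
    rw [h1, h2, h3, h4] at h
    simp only [hT]
    linear_combination h
  set k0 : Fin (p+q) := ⟨q, by omega⟩ with hk0
  set i0 : Fin (p+q) := ⟨0, by omega⟩ with hi0
  have hk0' : ¬ (k0 : ℕ) < q := by simp [hk0]
  have hi0' : (i0 : ℕ) < q := by simpa [hi0] using hq
  refine ⟨formPQ p q (A.mulVec (e k0)), hpos _ (by rw [hfe]; simp [hk0']), ?_⟩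
  rw [← BB_self]
  have hM : ∀ i j, (Aᴴ * Jmat p q * A) i j = T j i := by
    intro i j
    rw [Matrix.mul_apply]
    simp only [hT, he, BB, Jmat, Matrix.mul_diagonal, Matrix.conjTranspose_apply,
      Matrix.mulVec_single_one, Matrix.col_apply]
    refine Finset.sum_congr rfl fun k _ => ?_
    simp only [starRingEnd_apply]
    ring
  ext i j
  rw [hM, Matrix.smul_apply, Jmat, Matrix.diagonal_apply, smul_eq_mul]
  change T j i = T k0 k0 * _
  by_cases hij : i = j
  · subst hij
    by_cases hi : (i : ℕ) < q
    · simp [hi, t2 i k0 hi hk0']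
    · simp only [hi, if_true, if_false, mul_one]
      have h1 := t2 i0 k0 hi0' hk0'
      have h2 := t2 i0 i hi0' hi
      linear_combination h2 - h1
  · rw [if_neg hij, mul_zero]
    by_cases hi : (i : ℕ) < q <;> by_cases hj : (j : ℕ) < q
    · exact t3 j i k0 (Ne.symm hij) hj hi hk0'
    · exact t1 i j hi hj
    · exact hconj _ _ (t1 j i hj hi)
    · exact t4 i j i0 hij hi hj hi0'

/-- Let `p, q > 0`. If `f ∈ Aut(ℂ^{p+q})` preserves the domain
`D^{p,q}` and the null cone `∂D^{p,q}`, then `f` is a linear map belonging to `GU(p,q)`. -/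
theorem aut_preserving_Dpq_and_cone_is_GU (p q : ℕ) (hp : 0 < p) (hq : 0 < q)
    (f g : (Fin (p+q) → ℂ) → (Fin (p+q) → ℂ))
    (hf : Differentiable ℂ f) (hg : Differentiable ℂ g)
    (hgf : Function.LeftInverse g f) (hfg : Function.RightInverse g f)
    (hD : f '' Dpq p q = Dpq p q) (hC : f '' nullCone p q = nullCone p q) :
    ∃ A : Matrix (Fin (p+q)) (Fin (p+q)) ℂ, memGU p q A ∧ ∀ z, f z = A.mulVec z := by
  have fpos : ∀ z, 0 < formPQ p q (f z) ↔ 0 < formPQ p q z := by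
    intro z
    have h : f z ∈ f '' Dpq p q ↔ z ∈ Dpq p q := hgf.injective.mem_set_image
    rw [hD] at h; exact h
  have fnull : ∀ z, formPQ p q (f z) = 0 ↔ formPQ p q z = 0 := by
    intro z
    have h : f z ∈ f '' nullCone p q ↔ z ∈ nullCone p q := hgf.injective.mem_set_image
    rw [hC] at h; exact h
  have fneg : ∀ z, formPQ p q (f z) < 0 ↔ formPQ p q z < 0 := by
    intro z
    rw [← not_le, ← not_le, le_iff_lt_or_eq, le_iff_lt_or_eq, fpos z, eq_comm, fnull z,
      eq_comm (a := (0:ℝ))]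
  have f0 : f 0 = 0 := zero_fixed p q hp hq f g hf hfg fnull fneg
  have g0 : g 0 = 0 := by rw [← f0, hgf, f0]
  have hom := homog_all p q hp f hf (fun z hz c =>
    homog p q hq f g hf hg hgf hfg f0 g0 fpos fnull fneg z hz c)
  have hlin := linear_of_homog f hf hom
  have hA : ∀ z, f z = (LinearMap.toMatrix' (fderiv ℂ f 0 : (Fin (p+q) → ℂ) →ₗ[ℂ] (Fin (p+q) → ℂ))).mulVec z := by
    intro z
    rw [LinearMap.toMatrix'_mulVec]
    exact hlin z
  refine ⟨_, memGU_of_orth p q hp hq _ ?_ ?_, hA⟩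
  · intro z hz
    rw [← hA]; exact (fpos z).2 hz
  · intro z w hz hw h
    rw [← hA, ← hA]
    exact BB_symm_zero p q (orth p q f hf (fun x hx => (fnull x).2 hx) z w hz hw h)

end
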